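/- Let n > 3, s ≥ 1 and let Λ = (λ_1,…,λ_n), λ_j ∈ ℂ, be weakly hyperbolic. Let X = (w,z) ∈ Z_{(Λ,n,s)} with w_r ≠ 0 for every r ∈ {1,…,s}. Then α is a contact form at X: the only tangent vector v ∈ T_X satisfying α_X(v) = 0 and dα_X(v,u) = 0 for every u ∈ T_X is v = 0. -/

import Mathlib

open scoped BigOperators

/-- `Λ` is weakly hyperbolic (`k = 2`). -/
def WeaklyHyperbolicC {n : ℕ} (Λ : Fin n → ℂ) : Prop :=
  ∀ J : Finset (Fin n), J.card ≤ 2 → (0 : ℂ) ∉ convexHull ℝ (Λ '' ↑J)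

/-- The manifold `Z_{(Λ,n,s)} ⊆ ℂ^s × ℂ^n` cut out by
`F_s(w,z) = ∑ w_r² + ∑ λ_j |z_j|² = 0` and `ρ_s(w,z) = ∑ |w_r|² + ∑ |z_j|² = 1`. -/
def ZLS (s : ℕ) {n : ℕ} (Λ : Fin n → ℂ) : Set ((Fin s → ℂ) × (Fin n → ℂ)) :=
  {X | (∑ r, X.1 r ^ 2) + (∑ j, Λ j * (Complex.normSq (X.2 j) : ℂ)) = 0 ∧
       (∑ r, Complex.normSq (X.1 r)) + (∑ j, Complex.normSq (X.2 j)) = 1}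

/-- The tangent space of `Z_{(Λ,n,s)}` at `X = (w,z)`: all `v = (a,b) ∈ ℂ^s × ℂ^n` with
`∑ 2 w_r a_r + ∑ λ_j (conj(z_j) b_j + z_j conj(b_j)) = 0` and
`Re(∑ conj(w_r) a_r + ∑ conj(z_j) b_j) = 0`. -/
def TangentAt (s : ℕ) {n : ℕ} (Λ : Fin n → ℂ)
    (X v : (Fin s → ℂ) × (Fin n → ℂ)) : Prop :=
  ((∑ r, 2 * X.1 r * v.1 r) +
      (∑ j, Λ j * ((starRingEnd ℂ) (X.2 j) * v.2 j + X.2 j * (starRingEnd ℂ) (v.2 j))) = 0) ∧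
  ((∑ r, (starRingEnd ℂ) (X.1 r) * v.1 r) + (∑ j, (starRingEnd ℂ) (X.2 j) * v.2 j)).re = 0

/-- The `1`-form
`α_X(a,b) = i(∑ (w_r conj(a_r) − conj(w_r) a_r) + ∑ (z_j conj(b_j) − conj(z_j) b_j))`. -/
noncomputable def alphaForm {s n : ℕ} (X v : (Fin s → ℂ) × (Fin n → ℂ)) : ℂ :=
  Complex.I *
    ((∑ r, (X.1 r * (starRingEnd ℂ) (v.1 r) - (starRingEnd ℂ) (X.1 r) * v.1 r)) +
     (∑ j, (X.2 j * (starRingEnd ℂ) (v.2 j) - (starRingEnd ℂ) (X.2 j) * v.2 j)))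

/-- The constant `2`-form
`dα(u,v) = 2i(∑ (u_r conj(v_r) − v_r conj(u_r)) + ∑ (u_{s+j} conj(v_{s+j}) − v_{s+j} conj(u_{s+j})))`. -/
noncomputable def dAlpha {s n : ℕ} (u v : (Fin s → ℂ) × (Fin n → ℂ)) : ℂ :=
  2 * Complex.I *
    ((∑ r, (u.1 r * (starRingEnd ℂ) (v.1 r) - v.1 r * (starRingEnd ℂ) (u.1 r))) +
     (∑ j, (u.2 j * (starRingEnd ℂ) (v.2 j) - v.2 j * (starRingEnd ℂ) (u.2 j))))

/-- The vector `v(T,μ) = −i(2 conj(T) conj(w_1) + μ w_1, …, 2 conj(T) conj(w_s) + μ w_s,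
(2 Re(T λ_1) + μ) z_1, …, (2 Re(T λ_n) + μ) z_n)`. -/
noncomputable def vTmu {s n : ℕ} (Λ : Fin n → ℂ) (X : (Fin s → ℂ) × (Fin n → ℂ)) (T : ℂ) (μ : ℝ) :
    (Fin s → ℂ) × (Fin n → ℂ) :=
  (fun r => -Complex.I * (2 * (starRingEnd ℂ) T * (starRingEnd ℂ) (X.1 r) + (μ : ℂ) * X.1 r),
   fun j => -Complex.I * (((2 * (T * Λ j).re + μ : ℝ) : ℂ) * X.2 j))

open scoped ComplexConjugate

/-- Every vector of `ℂ^s × ℂ^n` becomes tangent at `X = (w, z)` after subtracting a complex multiple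
of `(conj w, 0)` and a real multiple of `X`, provided `w ≠ 0`. -/
theorem exists_tangentAt_sub {n s : ℕ} {Λ : Fin n → ℂ} {X : (Fin s → ℂ) × (Fin n → ℂ)}
    (hX : X ∈ ZLS s Λ) (hw : ∑ r, Complex.normSq (X.1 r) ≠ 0) (u : (Fin s → ℂ) × (Fin n → ℂ)) :
    ∃ (c : ℂ) (β : ℝ), TangentAt s Λ X
      (fun r => u.1 r - c * conj (X.1 r) - β * X.1 r, fun j => u.2 j - β * X.2 j) := by
  obtain ⟨hF, hρ⟩ := hX
  set W : ℝ := ∑ r, Complex.normSq (X.1 r) with hW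
  have hWC : (W : ℂ) ≠ 0 := by exact_mod_cast hw
  set g : ℂ := (∑ r, 2 * X.1 r * u.1 r) +
    ∑ j, Λ j * (conj (X.2 j) * u.2 j + X.2 j * conj (u.2 j)) with hg
  set c : ℂ := g / (2 * W) with hc
  set p : ℂ := (∑ r, conj (X.1 r) * (u.1 r - c * conj (X.1 r))) + ∑ j, conj (X.2 j) * u.2 j with hp
  refine ⟨c, p.re, ?_, ?_⟩
  · have hw_sum : ∑ r, 2 * X.1 r * (u.1 r - c * conj (X.1 r) - p.re * X.1 r) =
        (∑ r, 2 * X.1 r * u.1 r) - 2 * c * W - 2 * p.re * ∑ r, X.1 r ^ 2 := by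
      rw [hW, Complex.ofReal_sum, Finset.mul_sum, Finset.mul_sum, ← Finset.sum_sub_distrib,
        ← Finset.sum_sub_distrib]
      refine Finset.sum_congr rfl fun r _ => ?_
      rw [← Complex.mul_conj]
      ring
    have hz_sum : ∑ j, Λ j * (conj (X.2 j) * (u.2 j - p.re * X.2 j) +
          X.2 j * conj (u.2 j - p.re * X.2 j)) =
        (∑ j, Λ j * (conj (X.2 j) * u.2 j + X.2 j * conj (u.2 j))) -
          2 * p.re * ∑ j, Λ j * (Complex.normSq (X.2 j) : ℂ) := by
      rw [Finset.mul_sum, ← Finset.sum_sub_distrib]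
      refine Finset.sum_congr rfl fun j _ => ?_
      rw [← Complex.mul_conj, map_sub, map_mul, Complex.conj_ofReal]
      ring
    have hcW : 2 * c * W = g := by
      rw [hc]
      field_simp
    rw [hw_sum, hz_sum]
    linear_combination -hcW - hg - 2 * (p.re : ℂ) * hF
  · have hw_sum : ∑ r, conj (X.1 r) * (u.1 r - c * conj (X.1 r) - p.re * X.1 r) =
        (∑ r, conj (X.1 r) * (u.1 r - c * conj (X.1 r))) - p.re * W := by
      rw [hW, Complex.ofReal_sum, Finset.mul_sum, ← Finset.sum_sub_distrib]
      refine Finset.sum_congr rfl fun r _ => ?_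
      rw [← Complex.mul_conj]
      ring
    have hz_sum : ∑ j, conj (X.2 j) * (u.2 j - p.re * X.2 j) =
        (∑ j, conj (X.2 j) * u.2 j) - p.re * ((∑ j, Complex.normSq (X.2 j) : ℝ) : ℂ) := by
      rw [Complex.ofReal_sum, Finset.mul_sum, ← Finset.sum_sub_distrib]
      refine Finset.sum_congr rfl fun j _ => ?_
      rw [← Complex.mul_conj]
      ring
    have hρC : (W : ℂ) + ((∑ j, Complex.normSq (X.2 j) : ℝ) : ℂ) = 1 := by exact_mod_cast hρ
    have hsum : (∑ r, conj (X.1 r) * (u.1 r - c * conj (X.1 r) - p.re * X.1 r)) +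
        ∑ j, conj (X.2 j) * (u.2 j - p.re * X.2 j) = p - p.re := by
      rw [hw_sum, hz_sum]
      linear_combination -hp - (p.re : ℂ) * hρC
    rw [hsum, Complex.sub_re, Complex.ofReal_re, sub_self]

/-- The vector `i z_j ∂/∂z_j` generating the rotation of a single coordinate `z_j` is tangent. -/
theorem tangentAt_rotation {n s : ℕ} (Λ : Fin n → ℂ) (X : (Fin s → ℂ) × (Fin n → ℂ)) (j : Fin n) :
    TangentAt s Λ X (0, Pi.single j (Complex.I * X.2 j)) := by
  have hval : ∀ k, conj (X.2 k) * (Pi.single j (Complex.I * X.2 j) : Fin n → ℂ) k =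
      if k = j then Complex.I * (Complex.normSq (X.2 j) : ℂ) else 0 := by
    intro k
    split_ifs with h
    · subst h
      rw [Pi.single_eq_same, ← Complex.mul_conj]
      ring
    · rw [Pi.single_eq_of_ne h, mul_zero]
  have hre : ∀ k, conj (X.2 k) * (Pi.single j (Complex.I * X.2 j) : Fin n → ℂ) k +
      X.2 k * conj ((Pi.single j (Complex.I * X.2 j) : Fin n → ℂ) k) = 0 := by
    intro k
    have hconj := congrArg conj (hval k)
    rw [map_mul, Complex.conj_conj] at hconj
    rw [hconj, hval]
    split_ifs <;> simp
  refine ⟨?_, ?_⟩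
  · simp [hre]
  · simp [hval]

/-- `dα(v, i v) = 4 ‖v‖²` vanishes only for `v = 0`. -/
theorem eq_zero_of_dAlpha_I_mul {s n : ℕ} {v : (Fin s → ℂ) × (Fin n → ℂ)}
    (h : dAlpha v (fun r => Complex.I * v.1 r, fun j => Complex.I * v.2 j) = 0) : v = 0 := by
  have hterm : ∀ x : ℂ, x * conj (Complex.I * x) - Complex.I * x * conj x =
      -2 * Complex.I * (Complex.normSq x : ℂ) := by
    intro x
    rw [map_mul, Complex.conj_I, ← Complex.mul_conj]
    ring
  simp only [dAlpha, hterm, ← Finset.mul_sum, ← mul_add] at h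
  have hsum : (∑ r, Complex.normSq (v.1 r)) + ∑ j, Complex.normSq (v.2 j) = 0 := by
    have : (∑ r, (Complex.normSq (v.1 r) : ℂ)) + ∑ j, (Complex.normSq (v.2 j) : ℂ) = 0 := by
      simpa using h
    exact_mod_cast this
  have hnonneg₁ : ∀ r ∈ Finset.univ, 0 ≤ Complex.normSq (v.1 r) := fun r _ => Complex.normSq_nonneg _
  have hnonneg₂ : ∀ j ∈ Finset.univ, 0 ≤ Complex.normSq (v.2 j) := fun j _ => Complex.normSq_nonneg _
  obtain ⟨h₁, h₂⟩ :=
    (add_eq_zero_iff_of_nonneg (Finset.sum_nonneg hnonneg₁) (Finset.sum_nonneg hnonneg₂)).1 hsum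
  rw [Finset.sum_eq_zero_iff_of_nonneg hnonneg₁] at h₁
  rw [Finset.sum_eq_zero_iff_of_nonneg hnonneg₂] at h₂
  exact Prod.ext (funext fun r => Complex.normSq_eq_zero.1 (h₁ r (Finset.mem_univ r)))
    (funext fun j => Complex.normSq_eq_zero.1 (h₂ j (Finset.mem_univ j)))

/-- A tangent vector `v = (a, b)` in the kernel of `dα` on the tangent space satisfies
`∑ w_r a_r = 0`. -/
theorem sum_mul_eq_zero_of_dAlpha_eq_zero {n s : ℕ} {Λ : Fin n → ℂ}
    {X v : (Fin s → ℂ) × (Fin n → ℂ)} (hv : TangentAt s Λ X v)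
    (hker : ∀ u : (Fin s → ℂ) × (Fin n → ℂ), TangentAt s Λ X u → dAlpha v u = 0) :
    ∑ r, X.1 r * v.1 r = 0 := by
  have hre : ∀ j, conj (X.2 j) * v.2 j + X.2 j * conj (v.2 j) = 0 := by
    intro j
    have h := hker _ (tangentAt_rotation Λ X j)
    have hj : ∑ k, (v.2 k * conj ((Pi.single j (Complex.I * X.2 j) : Fin n → ℂ) k) -
        (Pi.single j (Complex.I * X.2 j) : Fin n → ℂ) k * conj (v.2 k)) =
        -Complex.I * (conj (X.2 j) * v.2 j + X.2 j * conj (v.2 j)) := by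
      rw [Finset.sum_eq_single j (fun k _ hk => by simp [Pi.single_eq_of_ne hk]) (by simp)]
      rw [Pi.single_eq_same, map_mul, Complex.conj_I]
      ring
    simp only [dAlpha, hj] at h
    simpa using h
  have h := hv.1
  simp only [hre, mul_zero, Finset.sum_const_zero, add_zero, mul_assoc, ← Finset.mul_sum] at h
  simpa using h

/-- If `∑ w_r a_r = 0` and `α_X(v) = 0` for `v = (a, b)`, then `dα(v, ·)` vanishes on the complex
multiples of `(conj w, 0)` and on the real multiples of `X`. -/
theorem dAlpha_sub_eq {n s : ℕ} {X v : (Fin s → ℂ) × (Fin n → ℂ)}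
    (hα : alphaForm X v = 0) (hwa : ∑ r, X.1 r * v.1 r = 0)
    (u : (Fin s → ℂ) × (Fin n → ℂ)) (c : ℂ) (β : ℝ) :
    dAlpha v (fun r => u.1 r - c * conj (X.1 r) - β * X.1 r, fun j => u.2 j - β * X.2 j) =
      dAlpha v u := by
  have hw_sum : ∑ r, (v.1 r * conj (u.1 r - c * conj (X.1 r) - β * X.1 r) -
        (u.1 r - c * conj (X.1 r) - β * X.1 r) * conj (v.1 r)) =
      (∑ r, (v.1 r * conj (u.1 r) - u.1 r * conj (v.1 r))) - conj c * (∑ r, X.1 r * v.1 r) +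
        c * (∑ r, conj (X.1 r * v.1 r)) +
        β * ∑ r, (X.1 r * conj (v.1 r) - conj (X.1 r) * v.1 r) := by
    rw [Finset.mul_sum, Finset.mul_sum, Finset.mul_sum, ← Finset.sum_sub_distrib,
      ← Finset.sum_add_distrib, ← Finset.sum_add_distrib]
    refine Finset.sum_congr rfl fun r _ => ?_
    simp only [map_sub, map_mul, Complex.conj_conj, Complex.conj_ofReal]
    ring
  have hz_sum : ∑ j, (v.2 j * conj (u.2 j - β * X.2 j) - (u.2 j - β * X.2 j) * conj (v.2 j)) =
      (∑ j, (v.2 j * conj (u.2 j) - u.2 j * conj (v.2 j))) +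
        β * ∑ j, (X.2 j * conj (v.2 j) - conj (X.2 j) * v.2 j) := by
    rw [Finset.mul_sum, ← Finset.sum_add_distrib]
    refine Finset.sum_congr rfl fun j _ => ?_
    simp only [map_sub, map_mul, Complex.conj_ofReal]
    ring
  have hwa_conj : ∑ r, conj (X.1 r * v.1 r) = 0 := by rw [← map_sum, hwa, map_zero]
  simp only [alphaForm] at hα
  simp only [dAlpha]
  rw [hw_sum, hz_sum, hwa, hwa_conj]
  linear_combination 2 * (β : ℂ) * hα

/-- At every point `X = (w,z) ∈ Z_{(Λ,n,s)}` with `w_r ≠ 0` for all `r`, the form `α` is a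
contact form: the only tangent vector `v` at `X` with `α_X(v) = 0` and `dα_X(v,u) = 0` for
every tangent vector `u` at `X` is `v = 0`. -/
theorem alpha_contact_off_W {n s : ℕ} (hn : 3 < n) (hs : 1 ≤ s)
    (Λ : Fin n → ℂ) (hΛ : WeaklyHyperbolicC Λ)
    (X : (Fin s → ℂ) × (Fin n → ℂ)) (hX : X ∈ ZLS s Λ) (hw : ∀ r, X.1 r ≠ 0)
    (v : (Fin s → ℂ) × (Fin n → ℂ)) (hv : TangentAt s Λ X v)
    (hα : alphaForm X v = 0)
    (hker : ∀ u : (Fin s → ℂ) × (Fin n → ℂ), TangentAt s Λ X u → dAlpha v u = 0) :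
    v = 0 := by
  have hpos : 0 < ∑ r, Complex.normSq (X.1 r) :=
    Finset.sum_pos (fun r _ => Complex.normSq_pos.2 (hw r)) ⟨⟨0, hs⟩, Finset.mem_univ _⟩
  obtain ⟨c, β, hT⟩ := exists_tangentAt_sub hX hpos.ne'
    (fun r => Complex.I * v.1 r, fun j => Complex.I * v.2 j)
  have h := hker _ hT
  rw [dAlpha_sub_eq hα (sum_mul_eq_zero_of_dAlpha_eq_zero hv hker)] at h
  exact eq_zero_of_dAlpha_I_mul h
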